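/- For all real numbers a and b with −1 < a ≤ b < 1, one has artanh(b) − artanh(a) ≤ (b − a) / (√(1 − a²) · √(1 − b²)); equivalently, (1/2) log((1 + b)/(1 − b)) − (1/2) log((1 + a)/(1 − a)) ≤ (b − a) / (√(1 − a²) · √(1 − b²)). -/

import Mathlib

/-- The inverse hyperbolic tangent, `artanh t = (1/2) log ((1 + t)/(1 - t))` for `t ∈ (-1, 1)`. -/
noncomputable def artanh (t : ℝ) : ℝ := (1 / 2) * Real.log ((1 + t) / (1 - t))

theorem Real.sinh_artanh_sub_artanh {a b : ℝ} (ha : a ∈ Set.Ioo (-1) 1) (hb : b ∈ Set.Ioo (-1) 1) :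
    Real.sinh (Real.artanh b - Real.artanh a) =
      (b - a) / (Real.sqrt (1 - a ^ 2) * Real.sqrt (1 - b ^ 2)) := by
  rw [Real.sinh_sub, Real.sinh_artanh ha, Real.sinh_artanh hb, Real.cosh_artanh ha,
    Real.cosh_artanh hb]
  ring

theorem Real.artanh_sub_artanh_le {a b : ℝ} (ha : -1 < a) (hab : a ≤ b) (hb : b < 1) :
    Real.artanh b - Real.artanh a ≤
      (b - a) / (Real.sqrt (1 - a ^ 2) * Real.sqrt (1 - b ^ 2)) := by
  rw [← Real.sinh_artanh_sub_artanh ⟨ha, hab.trans_lt hb⟩ ⟨ha.trans_le hab, hb⟩,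
    Real.self_le_sinh_iff, sub_nonneg]
  exact Real.artanh_le_artanh ha hb hab

theorem stmt16 (a b : ℝ) (ha : -1 < a) (hab : a ≤ b) (hb : b < 1) :
    artanh b - artanh a ≤ (b - a) / (Real.sqrt (1 - a ^ 2) * Real.sqrt (1 - b ^ 2)) ∧
      (1 / 2) * Real.log ((1 + b) / (1 - b)) - (1 / 2) * Real.log ((1 + a) / (1 - a)) ≤
        (b - a) / (Real.sqrt (1 - a ^ 2) * Real.sqrt (1 - b ^ 2)) := by
  have h := Real.artanh_sub_artanh_le ha hab hb
  rw [Real.artanh_eq_half_log ⟨by linarith, hb.le⟩,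
    Real.artanh_eq_half_log ⟨ha.le, by linarith⟩] at h
  exact ⟨h, h⟩
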